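/- arXiv:2409.19231 — 2 statements merged into one kernel-verified Lean document; each statement's English description precedes it below -/
import Mathlib

section
/- Let S and A be sets, let (s_t, a_t) ∈ S×A, α_t ∈ [0,1], and T_t ∈ ℝ be given for each t ≥ 0, and let Q^A_t, Q^B_t : S×A → ℝ be sequences of functions satisfying, for every t: Q^A_{t+1}(s_t,a_t) = Q^A_t(s_t,a_t) + α_t (T_t − Q^A_t(s_t,a_t)), Q^B_{t+1}(s_t,a_t) = Q^B_t(s_t,a_t) + α_t (T_t − Q^B_t(s_t,a_t)), and Q^A_{t+1}(s,a) = Q^A_t(s,a), Q^B_{t+1}(s,a) = Q^B_t(s,a) for all (s,a) ≠ (s_t,a_t). Then for every (s,a) and t, Q^B_{t+1}(s,a) − Q^A_{t+1}(s,a) = (1 − α_t·1[(s,a)=(s_t,a_t)]) (Q^B_t(s,a) − Q^A_t(s,a)). Moreover, if a pair (s,a) satisfies Σ_{t : (s_t,a_t)=(s,a)} α_t = ∞, then Q^B_t(s,a) − Q^A_t(s,a) → 0 as t → ∞. -/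
open Filter

/-- A real sequence contracted at each step by a factor `1 - b t` with `b t ∈ [0,1]` tends to `0`
when `b` is not summable. -/
theorem tendsto_zero_of_succ_eq_one_sub_mul {b d : ℕ → ℝ}
    (hb : ∀ t, b t ∈ Set.Icc (0 : ℝ) 1) (hd : ∀ t, d (t + 1) = (1 - b t) * d t)
    (hsum : ¬ Summable b) : Tendsto d atTop (nhds 0) := by
  have hbound : ∀ t, ‖d t‖ ≤ Real.exp (-∑ i ∈ Finset.range t, b i) * |d 0| := by
    intro t
    induction t with
    | zero => simp
    | succ t ih =>
      rw [hd, norm_mul, Real.norm_of_nonneg (sub_nonneg.2 (hb t).2), Finset.sum_range_succ,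
        neg_add_rev, Real.exp_add, mul_assoc]
      exact mul_le_mul (Real.one_sub_le_exp_neg _) ih (norm_nonneg _) (Real.exp_nonneg _)
  have htop := (not_summable_iff_tendsto_nat_atTop_of_nonneg fun t => (hb t).1).1 hsum
  refine squeeze_zero_norm hbound ?_
  simpa using (Real.tendsto_exp_neg_atTop_nhds_zero.comp htop).mul_const |d 0|

/-- If both tabular Q-values are updated at every step at the sampled pair `p t` with the
same learning rate `α t ∈ [0,1]` and the same TD target `Tt t` (all other entries frozen),
then their difference satisfies
`Q^B_{t+1}(q) − Q^A_{t+1}(q) = (1 − α_t·1[q = p_t]) (Q^B_t(q) − Q^A_t(q))`, and at every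
pair `q` with `∑_{t : p t = q} α t = ∞` the difference converges to `0`. -/
theorem simultaneous_update_difference_contracts
    {S A : Type*} [DecidableEq S] [DecidableEq A]
    (p : ℕ → S × A) (α : ℕ → ℝ) (hα : ∀ t, α t ∈ Set.Icc (0 : ℝ) 1)
    (Tt : ℕ → ℝ) (QA QB : ℕ → S × A → ℝ)
    (hupdA : ∀ t, QA (t + 1) (p t) = QA t (p t) + α t * (Tt t - QA t (p t)))
    (hupdB : ∀ t, QB (t + 1) (p t) = QB t (p t) + α t * (Tt t - QB t (p t)))
    (hfreezeA : ∀ t q, q ≠ p t → QA (t + 1) q = QA t q)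
    (hfreezeB : ∀ t q, q ≠ p t → QB (t + 1) q = QB t q) :
    (∀ t q, QB (t + 1) q - QA (t + 1) q
        = (1 - α t * (if q = p t then (1 : ℝ) else 0)) * (QB t q - QA t q)) ∧
    (∀ q, ¬ Summable (fun t => if p t = q then α t else 0) →
      Tendsto (fun t => QB t q - QA t q) atTop (nhds 0)) := by
  have hstep : ∀ t q, QB (t + 1) q - QA (t + 1) q
      = (1 - α t * (if q = p t then (1 : ℝ) else 0)) * (QB t q - QA t q) := by
    intro t q
    by_cases hq : q = p t
    · subst hq
      rw [hupdA, hupdB, if_pos rfl]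
      ring
    · rw [hfreezeA t q hq, hfreezeB t q hq, if_neg hq]
      ring
  refine ⟨hstep, fun q hq => tendsto_zero_of_succ_eq_one_sub_mul (fun t => ?_) (fun t => ?_) hq⟩
  · split_ifs
    · exact hα t
    · simp
  · simp only [hstep, mul_ite, mul_one, mul_zero, eq_comm]
end

section
/- Let A be a nonempty finite set and f, g : A → ℝ. Let a₁ ∈ A be a maximizer of f over A, and let a* ∈ A be either a maximizer of f over A or a maximizer of g over A. Then |min(f(a*), g(a*)) − f(a₁)| ≤ 2 · max_{a ∈ A} |f(a) − g(a)|. -/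
/-- Let `A` be a nonempty finite set, `f g : A → ℝ`, `a₁` a maximizer of `f` over `A`,
and `astar` either a maximizer of `f` or a maximizer of `g` over `A`. Then
`|min (f astar) (g astar) - f a₁| ≤ 2 * max_{a} |f a - g a|`. -/
theorem min_at_selected_maximizer_close_to_max
    {A : Type*} [Fintype A] [Nonempty A] (f g : A → ℝ)
    (a₁ astar : A)
    (ha₁ : ∀ a, f a ≤ f a₁)
    (hastar : (∀ a, f a ≤ f astar) ∨ (∀ a, g a ≤ g astar)) :
    |min (f astar) (g astar) - f a₁|
      ≤ 2 * Finset.univ.sup' Finset.univ_nonempty (fun a => |f a - g a|) := by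
  set M := Finset.univ.sup' Finset.univ_nonempty (fun a => |f a - g a|)
  have hM (a : A) : |f a - g a| ≤ M :=
    Finset.le_sup' (fun a => |f a - g a|) (Finset.mem_univ a)
  have h₁ := abs_le.mp (hM a₁)
  have hs := abs_le.mp (hM astar)
  have hle : min (f astar) (g astar) ≤ f a₁ := (min_le_left _ _).trans (ha₁ astar)
  have hge : f a₁ - 2 * M ≤ min (f astar) (g astar) := by
    rcases hastar with h | h <;> have := h a₁ <;> apply le_min <;> linarith
  rw [abs_le]
  constructor <;> linarith
end
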